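/- For every β > 0 and all x, y ∈ ℤ³, the square of the spontaneous magnetization is dominated by the infinite-volume plus-boundary two-point function: m*(β)² ≤ inf_{L > max(‖x‖_∞, ‖y‖_∞)} ⟨cos(θ_x − θ_y)⟩_{L,+,β}. -/

import Mathlib

open MeasureTheory Real Filter

noncomputable section

abbrev Site : Type := Fin 3 → ℤ

/-- Nearest-neighbor adjacency on `ℤ³`. -/
def adj (k l : Site) : Prop := (∑ i, |k i - l i|) = 1

instance (k l : Site) : Decidable (adj k l) := by unfold adj; infer_instance

/-- The interior `Λ_L° = ((-L,L) ∩ ℤ)³`. -/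
def interF (L : ℕ) : Finset Site := Finset.Icc (fun _ => -(L : ℤ) + 1) (fun _ => (L : ℤ) - 1)

/-- The box `Λ_L = ([-L,L] ∩ ℤ)³`. -/
def lamF (L : ℕ) : Finset Site := Finset.Icc (fun _ => -(L : ℤ)) (fun _ => (L : ℤ))

/-- Configurations of angles on the interior of `Λ_L`. -/
abbrev Cfg (L : ℕ) : Type := ↥(interF L) → ℝ

/-- The cube `[0,2π]^{Λ_L°}`. -/
def cube (L : ℕ) : Set (Cfg L) := Set.univ.pi fun _ => Set.Icc 0 (2 * π)

/-- Evaluation of a configuration at a site (`0` outside the interior). -/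
def val (L : ℕ) (θ : Cfg L) (x : Site) : ℝ := if h : x ∈ interF L then θ ⟨x, h⟩ else 0

/-- Free-boundary energy `(β/6) Σ_{k,l ∈ Λ_L°, |k-l|=1} cos(θ_k - θ_l)`. -/
def energy0 (L : ℕ) (β : ℝ) (θ : Cfg L) : ℝ :=
  β / 6 * ∑ k : ↥(interF L), ∑ l : ↥(interF L),
    if adj k.1 l.1 then Real.cos (θ k - θ l) else 0

/-- `N_∂(k)`, the number of boundary neighbors of `k`. -/
def nBd (L : ℕ) (k : Site) : ℕ := ((lamF L \ interF L).filter fun l => adj k l).card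

/-- Plus-boundary energy. -/
def energyP (L : ℕ) (β : ℝ) (θ : Cfg L) : ℝ :=
  energy0 L β θ + β / 3 * ∑ k : ↥(interF L), (nBd L k.1 : ℝ) * Real.cos (θ k)

/-- Free-boundary expectation `⟨F⟩_{L,0,β}`. -/
def avg0 (L : ℕ) (β : ℝ) (F : Cfg L → ℝ) : ℝ :=
  (∫ θ in cube L, F θ * Real.exp (energy0 L β θ)) / ∫ θ in cube L, Real.exp (energy0 L β θ)

/-- Plus-boundary expectation `⟨F⟩_{L,+,β}`. -/
def avgP (L : ℕ) (β : ℝ) (F : Cfg L → ℝ) : ℝ :=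
  (∫ θ in cube L, F θ * Real.exp (energyP L β θ)) / ∫ θ in cube L, Real.exp (energyP L β θ)

/-- Free-boundary two-point function `⟨cos(θ_x - θ_y)⟩_{L,0,β}`. -/
def corr0 (L : ℕ) (β : ℝ) (x y : Site) : ℝ :=
  avg0 L β fun θ => Real.cos (val L θ x - val L θ y)

/-- Plus-boundary two-point function `⟨cos(θ_x - θ_y)⟩_{L,+,β}`. -/
def corrPlus (L : ℕ) (β : ℝ) (x y : Site) : ℝ :=
  avgP L β fun θ => Real.cos (val L θ x - val L θ y)

/-- Finite-volume plus-boundary magnetization at site `y`. -/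
def magAt (L : ℕ) (β : ℝ) (y : Site) : ℝ := avgP L β fun θ => Real.cos (val L θ y)

/-- The spontaneous magnetization `m*(β) = inf_{L ≥ 2} ⟨cos θ_0⟩_{L,+,β}`. -/
def mStar (β : ℝ) : ℝ := sInf {r : ℝ | ∃ L : ℕ, 2 ≤ L ∧ r = magAt L β 0}

/-- The critical inverse temperature `β_c`. -/
def critBeta : ℝ := sSup {β : ℝ | 0 < β ∧ mStar β = 0}

/-- Sup-norm on `ℤ³`. -/
def supNorm (x : Site) : ℤ := max |x 0| (max |x 1| |x 2|)

/-- Infinite-volume free-boundary two-point function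
`⟨S_x·S_y⟩_{0,β} = sup_{L > max(‖x‖∞,‖y‖∞)} ⟨cos(θ_x - θ_y)⟩_{L,0,β}`. -/
def S20 (β : ℝ) (x y : Site) : ℝ :=
  sSup {r : ℝ | ∃ L : ℕ, max (supNorm x) (supNorm y) < (L : ℤ) ∧ r = corr0 L β x y}

/-- The box `B_n = {z ∈ ℤ³ : max |z_i| ≤ n}`. -/
def Bn (n : ℕ) : Finset Site := Finset.Icc (fun _ => -(n : ℤ)) (fun _ => (n : ℤ))

/-- Fundamental domain `{-L,…,L-1}³` for the torus `T_L = (ℤ/2Lℤ)³`. -/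
def torF (L : ℕ) : Finset Site := Finset.Icc (fun _ => -(L : ℤ)) (fun _ => (L : ℤ) - 1)

/-- Distance on `ℤ/2Lℤ`. -/
def torDist (L : ℕ) (m : ℤ) : ℤ := min (m % (2 * (L : ℤ))) (2 * (L : ℤ) - m % (2 * (L : ℤ)))

/-- Graph adjacency on the torus `T_L`. -/
def adjT (L : ℕ) (k l : Site) : Prop := (∑ i, torDist L (k i - l i)) = 1

instance (L : ℕ) (k l : Site) : Decidable (adjT L k l) := by unfold adjT; infer_instance

abbrev TCfg (L : ℕ) : Type := ↥(torF L) → ℝ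

def cubeT (L : ℕ) : Set (TCfg L) := Set.univ.pi fun _ => Set.Icc 0 (2 * π)

def valT (L : ℕ) (θ : TCfg L) (x : Site) : ℝ := if h : x ∈ torF L then θ ⟨x, h⟩ else 0

/-- Periodic-boundary energy on the torus `T_L`. -/
def energyT (L : ℕ) (β : ℝ) (θ : TCfg L) : ℝ :=
  β / 6 * ∑ k : ↥(torF L), ∑ l : ↥(torF L),
    if adjT L k.1 l.1 then Real.cos (θ k - θ l) else 0

/-- Periodic-boundary expectation `⟨F⟩_{L,P,β}`. -/
def avgT (L : ℕ) (β : ℝ) (F : TCfg L → ℝ) : ℝ :=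
  (∫ θ in cubeT L, F θ * Real.exp (energyT L β θ)) / ∫ θ in cubeT L, Real.exp (energyT L β θ)

/-- Periodic two-point function `⟨cos(θ_x - θ_y)⟩_{L,P,β}`. -/
def corrT (L : ℕ) (β : ℝ) (x y : Site) : ℝ :=
  avgT L β fun θ => Real.cos (valT L θ x - valT L θ y)

/-- `Ĵ(k) = (cos k₁ + cos k₂ + cos k₃)/3`. -/
def Jhat (k : Fin 3 → ℝ) : ℝ := (Real.cos (k 0) + Real.cos (k 1) + Real.cos (k 2)) / 3

/-- The cube `[-π,π]³`. -/
def Qpi : Set (Fin 3 → ℝ) := Set.univ.pi fun _ => Set.Icc (-π) π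

/-- The lattice Green-type function `G(v)`. -/
def green (v : Site) : ℝ :=
  ((2 * π) ^ 3)⁻¹ * ∫ k in Qpi, Real.cos (∑ i, k i * (v i : ℝ)) / (1 - Jhat k)

/-- `G(x,y) := G(x-y)`. -/
def greenXY (x y : Site) : ℝ := green (x - y)

end

/-! ### The circle as a compact group with Haar measure -/

instance fact_two_pi_pos : Fact ((0 : ℝ) < 2 * π) := ⟨Real.two_pi_pos⟩

noncomputable instance Real.Angle.instMeasureSpace : MeasureSpace Real.Angle :=
  inferInstanceAs (MeasureSpace (AddCircle (2 * π)))

instance Real.Angle.instBorelSpace : BorelSpace Real.Angle :=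
  inferInstanceAs (BorelSpace (AddCircle (2 * π)))

instance Real.Angle.instCompactSpace : CompactSpace Real.Angle :=
  inferInstanceAs (CompactSpace (AddCircle (2 * π)))

instance Real.Angle.instSecondCountableTopology : SecondCountableTopology Real.Angle :=
  inferInstanceAs (SecondCountableTopology (AddCircle (2 * π)))

instance Real.Angle.instIsAddHaarMeasure : (volume : Measure Real.Angle).IsAddHaarMeasure :=
  inferInstanceAs (volume : Measure (AddCircle (2 * π))).IsAddHaarMeasure

theorem Real.Angle.exists_add_self_eq (a : Real.Angle) : ∃ b : Real.Angle, b + b = a := by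
  induction a using Real.Angle.induction_on with
  | _ r => exact ⟨((r / 2 : ℝ) : Real.Angle), by rw [← Real.Angle.coe_add, add_halves]⟩

theorem Real.Angle.cos_sub' (a b : Real.Angle) :
    (a - b).cos = a.cos * b.cos + a.sin * b.sin := by
  rw [sub_eq_add_neg, Real.Angle.cos_add, Real.Angle.cos_neg, Real.Angle.sin_neg]; ring

theorem Continuous.integrable_of_compactSpace {X : Type*} [TopologicalSpace X] [CompactSpace X]
    [MeasurableSpace X] [OpensMeasurableSpace X] {μ : Measure X} [IsFiniteMeasureOnCompacts μ]
    {f : X → ℝ} (hf : Continuous f) : Integrable f μ :=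
  hf.integrable_of_hasCompactSupport (HasCompactSupport.of_compactSpace f)

theorem MeasureTheory.MeasurePreserving.integral_comp_continuous {X Y : Type*} [TopologicalSpace Y]
    [MeasurableSpace X] [MeasurableSpace Y] [OpensMeasurableSpace Y]
    [SecondCountableTopology Y] {μ : Measure X} {ν : Measure Y} {φ : X → Y}
    (hφ : MeasurePreserving φ μ ν) {f : Y → ℝ} (hf : Continuous f) :
    ∫ x, f (φ x) ∂μ = ∫ y, f y ∂ν := by
  rw [← hφ.map_eq, integral_map hφ.measurable.aemeasurable]
  exact hf.measurable.aestronglyMeasurable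

/-! ### Closed cones of functions with nonnegative integral -/

section Cone

variable {X : Type*} [TopologicalSpace X] [CompactSpace X]

/-- `F` lies in the closed semiring generated by the multiplicative family `M`. -/
def InCone (M : Submonoid C(X, ℝ)) (F : X → ℝ) : Prop :=
  ∃ f ∈ M.subsemiringClosure.topologicalClosure, ∀ x, f x = F x

variable {M : Submonoid C(X, ℝ)} {F G : X → ℝ}

theorem InCone.of_mem {f : C(X, ℝ)} (hf : f ∈ M) : InCone M f :=
  ⟨f, Subsemiring.le_topologicalClosure _ (by
    rw [← SetLike.mem_coe, Submonoid.subsemiringClosure_coe]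
    exact AddSubmonoid.subset_closure hf), fun _ => rfl⟩

theorem InCone.add (hF : InCone M F) (hG : InCone M G) : InCone M fun x => F x + G x := by
  obtain ⟨f, hf, hfF⟩ := hF
  obtain ⟨g, hg, hgG⟩ := hG
  exact ⟨f + g, add_mem hf hg, fun x => by simp [hfF, hgG]⟩

theorem InCone.mul (hF : InCone M F) (hG : InCone M G) : InCone M fun x => F x * G x := by
  obtain ⟨f, hf, hfF⟩ := hF
  obtain ⟨g, hg, hgG⟩ := hG
  exact ⟨f * g, mul_mem hf hg, fun x => by simp [hfF, hgG]⟩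

theorem InCone.sum {κ : Type*} (s : Finset κ) {F : κ → X → ℝ} (hF : ∀ k ∈ s, InCone M (F k)) :
    InCone M fun x => ∑ k ∈ s, F k x := by
  choose! f hf hfF using hF
  exact ⟨∑ k ∈ s, f k, sum_mem hf, fun x => by
    simp only [ContinuousMap.coe_sum, Finset.sum_apply]
    exact Finset.sum_congr rfl fun k hk => hfF k hk x⟩

theorem InCone.exp (hM : ∀ c : ℝ, 0 ≤ c → ContinuousMap.const X c ∈ M) (hF : InCone M F) :
    InCone M fun x => Real.exp (F x) := by
  obtain ⟨f, hf, hfF⟩ := hF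
  refine ⟨NormedSpace.exp f, ?_, fun x => ?_⟩
  · have hs := NormedSpace.exp_series_hasSum_exp' (𝕂 := ℝ) f
    refine (Subsemiring.isClosed_topologicalClosure M.subsemiringClosure).mem_of_tendsto hs
      (Eventually.of_forall fun s => ?_)
    refine sum_mem fun n _ => ?_
    have h1 : ContinuousMap.const X ((n.factorial : ℝ)⁻¹) ∈
        M.subsemiringClosure.topologicalClosure := by
      obtain ⟨g, hg, hgF⟩ := InCone.of_mem (hM ((n.factorial : ℝ)⁻¹) (by positivity))
      rwa [← ContinuousMap.ext hgF]
    have h2 : ((n.factorial : ℝ)⁻¹) • f ^ n =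
        ContinuousMap.const X ((n.factorial : ℝ)⁻¹) * f ^ n := by
      ext x; simp
    rw [h2]
    exact mul_mem h1 (pow_mem hf n)
  · have h := NormedSpace.map_exp (ContinuousMap.evalAlgHom ℝ ℝ x : C(X, ℝ) →ₐ[ℝ] ℝ)
      (continuous_eval_const x) f
    simp only [ContinuousMap.evalAlgHom_apply] at h
    rw [h, hfF, Real.exp_eq_exp_ℝ]

theorem InCone.integral_nonneg [MeasurableSpace X] [BorelSpace X] {μ : Measure X}
    [IsFiniteMeasure μ] (hM : ∀ f ∈ M, 0 ≤ ∫ x, f x ∂μ) (hF : InCone M F) :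
    0 ≤ ∫ x, F x ∂μ := by
  obtain ⟨f, hf, hfF⟩ := hF
  simp only [← hfF]
  have hint : ∀ f : C(X, ℝ), Integrable (fun x => f x) μ := fun f =>
    f.continuous.integrable_of_compactSpace
  have hcont : Continuous fun f : C(X, ℝ) => ∫ x, f x ∂μ := by
    refine continuous_iff_continuousAt.2 fun f => ?_
    refine tendsto_integral_filter_of_dominated_convergence (fun _ => ‖f‖ + 1) ?_ ?_ ?_ ?_
    · exact Eventually.of_forall fun g => (hint g).aestronglyMeasurable
    · filter_upwards [Metric.ball_mem_nhds f one_pos] with g hg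
      refine Eventually.of_forall fun x => (g.norm_coe_le_norm x).trans ?_
      have : ‖g‖ ≤ ‖f‖ + ‖g - f‖ := by simpa using norm_add_le f (g - f)
      rw [mem_ball_iff_norm] at hg
      linarith
    · exact integrable_const _
    · exact Eventually.of_forall fun x =>
        (continuous_eval_const x).tendsto f
  have hclosed : IsClosed {f : C(X, ℝ) | 0 ≤ ∫ x, f x ∂μ} := isClosed_le continuous_const hcont
  have hsub : (M.subsemiringClosure : Set C(X, ℝ)) ⊆ {f : C(X, ℝ) | 0 ≤ ∫ x, f x ∂μ} := by
    rw [Submonoid.subsemiringClosure_coe]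
    intro g hg
    induction hg using AddSubmonoid.closure_induction with
    | mem g hg => exact hM g hg
    | zero => simp
    | add g h _ _ hg hh =>
      have : ∫ x, (g + h) x ∂μ = ∫ x, g x ∂μ + ∫ x, h x ∂μ := integral_add (hint g) (hint h)
      simp only [Set.mem_ofPred_eq] at hg hh ⊢
      linarith
  exact closure_minimal hsub hclosed hf

end Cone

/-! ### Reflection cone: weights even in every angle times monomials in the sines -/

section Reflection

variable {ι : Type*} [Fintype ι]

open scoped Classical in
/-- Reflection of the `k`-th angle. -/
noncomputable def reflect (k : ι) (θ : ι → Real.Angle) : ι → Real.Angle :=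
  fun j => if j = k then -θ j else θ j

theorem measurePreserving_reflect (k : ι) :
    MeasurePreserving (reflect k) (volume : Measure (ι → Real.Angle)) volume := by
  classical
  let f : (ι → Real.Angle) →+ (ι → Real.Angle) :=
    { toFun := reflect k
      map_zero' := by ext j; simp [reflect]
      map_add' := fun a b => by
        ext j; simp only [reflect, Pi.add_apply]; split_ifs <;> abel }
  have hf : Continuous f := by
    refine continuous_pi fun j => ?_
    change Continuous fun θ : ι → Real.Angle => if j = k then -θ j else θ j
    split_ifs <;> fun_prop
  refine AddMonoidHom.measurePreserving (f := f) hf (fun θ => ⟨reflect k θ, ?_⟩) rfl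
  ext j
  change reflect k (reflect k θ) j = θ j
  simp only [reflect]; split_ifs <;> simp

/-- Nonnegative reflection-invariant weights times monomials in the sines. -/
def reflectionMonoid (ι : Type*) [Fintype ι] : Submonoid C(ι → Real.Angle, ℝ) where
  carrier := {f | ∃ (A : ι → ℕ) (w : C(ι → Real.Angle, ℝ)), (∀ θ, 0 ≤ w θ) ∧
    (∀ k θ, w (reflect k θ) = w θ) ∧ ∀ θ, f θ = w θ * ∏ j, (θ j).sin ^ A j}
  one_mem' := ⟨0, 1, by simp, by simp, by simp⟩
  mul_mem' := by
    rintro f g ⟨A, w, hw, hwk, hf⟩ ⟨B, v, hv, hvk, hg⟩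
    refine ⟨A + B, w * v, fun θ => mul_nonneg (hw θ) (hv θ), fun k θ => ?_, fun θ => ?_⟩
    · simp [hwk, hvk]
    · simp only [ContinuousMap.mul_apply, hf, hg, Pi.add_apply, pow_add, Finset.prod_mul_distrib]
      ring

theorem integral_nonneg_of_mem_reflectionMonoid {f : C(ι → Real.Angle, ℝ)}
    (hf : f ∈ reflectionMonoid ι) : 0 ≤ ∫ θ, f θ := by
  classical
  obtain ⟨A, w, hw, hwk, hf⟩ := hf
  by_cases hA : ∀ k, Even (A k)
  · refine integral_nonneg fun θ => ?_
    change 0 ≤ f θ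
    rw [hf]
    exact mul_nonneg (hw θ) (Finset.prod_nonneg fun j _ => (hA j).pow_nonneg _)
  · push Not at hA
    obtain ⟨k, hk⟩ := hA
    have h1 := (measurePreserving_reflect k).integral_comp_continuous f.continuous
    have h2 : ∀ θ, f (reflect k θ) = -f θ := by
      intro θ
      have h3 : ∏ j, (reflect k θ j).sin ^ A j = -∏ j, (θ j).sin ^ A j := by
        rw [← Finset.mul_prod_erase _ _ (Finset.mem_univ k),
          ← Finset.mul_prod_erase _ (fun j => (θ j).sin ^ A j) (Finset.mem_univ k)]
        have h4 : ∏ j ∈ Finset.univ.erase k, (reflect k θ j).sin ^ A j =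
            ∏ j ∈ Finset.univ.erase k, (θ j).sin ^ A j :=
          Finset.prod_congr rfl fun j hj => by simp [reflect, Finset.ne_of_mem_erase hj]
        rw [h4]
        simp [reflect, (Nat.not_even_iff_odd.1 hk).neg_pow]
      rw [hf, hf, hwk, h3]; ring
    simp only [h2, integral_neg] at h1
    linarith

theorem inCone_reflection_sin (k : ι) :
    InCone (reflectionMonoid ι) fun θ => (θ k).sin := by
  classical
  refine InCone.of_mem (f := (⟨fun θ => (θ k).sin,
    Real.Angle.continuous_sin.comp (continuous_apply k)⟩ : C(ι → Real.Angle, ℝ)))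
    ⟨Pi.single k 1, 1, by simp, by simp, fun θ => ?_⟩
  simp [Pi.single_apply, pow_ite]

theorem inCone_reflection_weight {w : (ι → Real.Angle) → ℝ} (hc : Continuous w)
    (h0 : ∀ θ, 0 ≤ w θ) (hw : ∀ k θ, w (reflect k θ) = w θ) : InCone (reflectionMonoid ι) w :=
  InCone.of_mem (f := (⟨w, hc⟩ : C(ι → Real.Angle, ℝ))) ⟨0, ⟨w, hc⟩, h0, hw, by simp⟩

theorem const_mem_reflectionMonoid (c : ℝ) (hc : 0 ≤ c) :
    ContinuousMap.const _ c ∈ reflectionMonoid ι :=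
  ⟨0, ContinuousMap.const _ c, by simpa, by simp, by simp⟩

end Reflection

/-! ### Duplicated variables: kernels `f a * f b` after a rotation of the two replicas -/

section Ginibre

variable {ι : Type*}

/-- Kernels of the form `f a * f b`. -/
def replicaMonoid (Y : Type*) [TopologicalSpace Y] : Submonoid C(Y × Y, ℝ) where
  carrier := {F | ∃ f : C(Y, ℝ), ∀ z, F z = f z.1 * f z.2}
  one_mem' := ⟨1, by simp⟩
  mul_mem' := by
    rintro F G ⟨f, hf⟩ ⟨g, hg⟩
    exact ⟨f * g, fun z => by simp only [ContinuousMap.mul_apply, hf, hg]; ring⟩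

theorem const_mem_replicaMonoid {Y : Type*} [TopologicalSpace Y] (c : ℝ) (hc : 0 ≤ c) :
    ContinuousMap.const _ c ∈ replicaMonoid Y :=
  ⟨ContinuousMap.const _ (√c), fun z => by simp [Real.mul_self_sqrt hc]⟩

theorem inCone_replica {Y : Type*} [TopologicalSpace Y] [CompactSpace Y] {f : Y → ℝ}
    (hf : Continuous f) : InCone (replicaMonoid Y) fun z => f z.1 * f z.2 :=
  InCone.of_mem (f := (⟨fun z => f z.1 * f z.2, by fun_prop⟩ : C(Y × Y, ℝ))) ⟨⟨f, hf⟩, by simp⟩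

theorem inCone_replica_const {Y : Type*} [TopologicalSpace Y] [CompactSpace Y] {c : ℝ}
    (hc : 0 ≤ c) : InCone (replicaMonoid Y) fun _ => c :=
  InCone.of_mem (const_mem_replicaMonoid c hc)

/-- The two-to-one rotation `(a, b) ↦ (a - b, a + b)` of the two replicas. -/
noncomputable def replicaRotation (ι : Type*) : (ι → Real.Angle) × (ι → Real.Angle) →+
    (ι → Real.Angle) × (ι → Real.Angle) where
  toFun z := (z.1 - z.2, z.1 + z.2)
  map_zero' := by simp
  map_add' x y := by ext <;> simp <;> abel

theorem Real.Angle.cos_add_cos_rotation (a b d : Real.Angle) :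
    (a - b).cos + (a + b - (d + d)).cos = 2 * ((a - d).cos * (b - d).cos) := by
  have h1 : a - b = (a - d) - (b - d) := by abel
  have h2 : a + b - (d + d) = (a - d) + (b - d) := by abel
  rw [h1, h2, Real.Angle.cos_sub', Real.Angle.cos_add]; ring

theorem Real.Angle.cos_add_cos_rotation_sub (a b a' b' : Real.Angle) :
    ((a - b) - (a' - b')).cos + ((a + b) - (a' + b')).cos =
      2 * ((a - a').cos * (b - b').cos) := by
  have h1 : (a - b) - (a' - b') = (a - a') - (b - b') := by abel
  have h2 : (a + b) - (a' + b') = (a - a') + (b - b') := by abel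
  rw [h1, h2, Real.Angle.cos_sub', Real.Angle.cos_add]; ring

theorem Real.Angle.cos_add_cos_eq (a b : Real.Angle) :
    (a - b).cos + (a + b).cos = 2 * (a.cos * b.cos) := by
  rw [Real.Angle.cos_sub', Real.Angle.cos_add]; ring

theorem Real.Angle.cos_sub_cos_eq (a b : Real.Angle) :
    (a - b).cos - (a + b).cos = 2 * (a.sin * b.sin) := by
  rw [Real.Angle.cos_sub', Real.Angle.cos_add]; ring

theorem continuous_cos_apply (x : ι) : Continuous fun θ : ι → Real.Angle => (θ x).cos :=
  Real.Angle.continuous_cos.comp (continuous_apply x)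

theorem inCone_cos_sub_cos (x : ι) : InCone (replicaMonoid (ι → Real.Angle)) fun z =>
    ((z.1 - z.2) x).cos - ((z.1 + z.2) x).cos := by
  simp only [Pi.sub_apply, Pi.add_apply, Real.Angle.cos_sub_cos_eq]
  exact (inCone_replica_const zero_le_two).mul
    (inCone_replica (f := fun θ : ι → Real.Angle => (θ x).sin)
      (Real.Angle.continuous_sin.comp (continuous_apply x)))

theorem inCone_cos_add_cos (x : ι) : InCone (replicaMonoid (ι → Real.Angle)) fun z =>
    ((z.1 - z.2) x).cos + ((z.1 + z.2) x).cos := by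
  simp only [Pi.sub_apply, Pi.add_apply, Real.Angle.cos_add_cos_eq]
  exact (inCone_replica_const zero_le_two).mul (inCone_replica (continuous_cos_apply x))

variable [Fintype ι]

instance isAddHaarMeasure_replica :
    (volume : Measure ((ι → Real.Angle) × (ι → Real.Angle))).IsAddHaarMeasure :=
  have : MeasurableAdd (ι → Real.Angle) := inferInstance
  have : SFinite (volume : Measure (ι → Real.Angle)) := inferInstance
  have : (volume : Measure (ι → Real.Angle)).IsAddHaarMeasure := inferInstance
  Measure.prod.instIsAddHaarMeasure _ _

theorem measurePreserving_replicaRotation : MeasurePreserving (replicaRotation ι)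
    (volume : Measure ((ι → Real.Angle) × (ι → Real.Angle))) volume := by
  refine AddMonoidHom.measurePreserving (f := replicaRotation ι) ?_ (fun z => ?_) rfl
  · change Continuous fun z : (ι → Real.Angle) × (ι → Real.Angle) => (z.1 - z.2, z.1 + z.2)
    fun_prop
  · choose b hb using fun k => Real.Angle.exists_add_self_eq (z.2 k - z.1 k)
    refine ⟨(z.1 + b, b), ?_⟩
    change (z.1 + b - b, z.1 + b + b) = z
    refine Prod.ext (by simp) (funext fun k => ?_)
    simp [add_assoc, hb]

theorem integral_nonneg_of_inCone_rotation {F : (ι → Real.Angle) × (ι → Real.Angle) → ℝ}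
    (hF : Continuous F)
    (h : InCone (replicaMonoid (ι → Real.Angle)) fun z => F (z.1 - z.2, z.1 + z.2)) :
    0 ≤ ∫ z, F z := by
  rw [← measurePreserving_replicaRotation.integral_comp_continuous hF]
  refine InCone.integral_nonneg (M := replicaMonoid (ι → Real.Angle)) ?_ h
  rintro f ⟨g, hg⟩
  simp only [hg]
  rw [Measure.volume_eq_prod, integral_prod_mul]
  exact mul_self_nonneg _

/-- XY energy with pair couplings `J` and fields `h` pointing in the direction of angle `0`. -/
noncomputable def plusEnergy (J : ι → ι → ℝ) (h : ι → ℝ) (θ : ι → Real.Angle) : ℝ :=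
  ∑ k, ∑ l, J k l * (θ k - θ l).cos + ∑ k, h k * (θ k).cos

/-- XY energy with pair couplings `J`, fields `h` and couplings `g` to frozen angles `η`. -/
noncomputable def frozenEnergy {κ : Type*} [Fintype κ] (J : ι → ι → ℝ) (h : ι → ℝ)
    (g : ι → κ → ℝ) (η : κ → Real.Angle) (θ : ι → Real.Angle) : ℝ :=
  plusEnergy J h θ + ∑ k, ∑ l, g k l * (θ k - η l).cos

variable {κ : Type*} [Fintype κ] {J : ι → ι → ℝ} {h : ι → ℝ} {g : ι → κ → ℝ}

theorem continuous_plusEnergy : Continuous (plusEnergy J h) := by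
  have := Real.Angle.continuous_cos
  unfold plusEnergy
  refine Continuous.add ?_ ?_
  · exact continuous_finsetSum _ fun k _ => continuous_finsetSum _ fun l _ =>
      continuous_const.mul (this.comp (by fun_prop))
  · exact continuous_finsetSum _ fun k _ => continuous_const.mul (continuous_cos_apply k)

theorem continuous_frozenEnergy :
    Continuous fun z : (ι → Real.Angle) × (κ → Real.Angle) => frozenEnergy J h g z.2 z.1 := by
  have := Real.Angle.continuous_cos
  refine (continuous_plusEnergy.comp continuous_fst).add ?_
  exact continuous_finsetSum _ fun k _ => continuous_finsetSum _ fun l _ =>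
      continuous_const.mul (this.comp (by fun_prop))

theorem frozenEnergy_zero (η : κ → Real.Angle) :
    frozenEnergy J h (0 : ι → κ → ℝ) η = plusEnergy J h := by
  ext θ; simp [frozenEnergy]

theorem inCone_exp_energy (hJ : ∀ k l, 0 ≤ J k l) (hh : ∀ k, 0 ≤ h k)
    (hg : ∀ k l, 0 ≤ g k l) (η : κ → Real.Angle) :
    InCone (replicaMonoid (ι → Real.Angle)) fun z =>
      Real.exp (plusEnergy J (fun k => h k + ∑ l, g k l) (z.1 - z.2) +
        frozenEnergy J h g η (z.1 + z.2)) := by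
  have hcos := Real.Angle.continuous_cos
  choose d hd using fun l => Real.Angle.exists_add_self_eq (η l)
  refine InCone.exp const_mem_replicaMonoid ?_
  have key : InCone (replicaMonoid (ι → Real.Angle)) fun z =>
      (∑ k, ∑ l, J k l * (2 * ((z.1 k - z.1 l).cos * (z.2 k - z.2 l).cos)) +
        ∑ k, h k * (2 * ((z.1 k).cos * (z.2 k).cos))) +
        ∑ k, ∑ l, g k l * (2 * ((z.1 k - d l).cos * (z.2 k - d l).cos)) := by
    have h2 := inCone_replica_const (Y := ι → Real.Angle) zero_le_two
    refine (InCone.add ?_ ?_).add ?_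
    · exact InCone.sum _ fun k _ => InCone.sum _ fun l _ =>
        (inCone_replica_const (hJ k l)).mul (h2.mul
          (inCone_replica (f := fun θ : ι → Real.Angle => (θ k - θ l).cos)
            (hcos.comp (by fun_prop))))
    · exact InCone.sum _ fun k _ =>
        (inCone_replica_const (hh k)).mul (h2.mul (inCone_replica (continuous_cos_apply k)))
    · exact InCone.sum _ fun k _ => InCone.sum _ fun l _ =>
        (inCone_replica_const (hg k l)).mul (h2.mul
          (inCone_replica (f := fun θ : ι → Real.Angle => (θ k - d l).cos)
            (hcos.comp (by fun_prop))))
  convert key using 2 with z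
  have h1 := fun k l => Real.Angle.cos_add_cos_rotation_sub (z.1 k) (z.2 k) (z.1 l) (z.2 l)
  have h2 := fun k => Real.Angle.cos_add_cos_eq (z.1 k) (z.2 k)
  have h3 := fun k l => Real.Angle.cos_add_cos_rotation (z.1 k) (z.2 k) (d l)
  simp only [← h1, ← h2, ← h3, hd, mul_add, add_mul, Finset.sum_mul, Finset.sum_add_distrib,
    plusEnergy, frozenEnergy, Pi.add_apply, Pi.sub_apply]
  ring

theorem inCone_exp_plusEnergy (hJ : ∀ k l, 0 ≤ J k l) (hh : ∀ k, 0 ≤ h k) :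
    InCone (replicaMonoid (ι → Real.Angle)) fun z =>
      Real.exp (plusEnergy J h (z.1 - z.2) + plusEnergy J h (z.1 + z.2)) := by
  have := inCone_exp_energy (κ := ι) (g := 0) hJ hh (fun _ _ => le_rfl) 0
  simpa [frozenEnergy_zero] using this

theorem integral_prod_sub_mul {f f' g g' : (ι → Real.Angle) → ℝ} (hf : Continuous f)
    (hf' : Continuous f') (hg : Continuous g) (hg' : Continuous g') :
    ∫ z : (ι → Real.Angle) × (ι → Real.Angle), (f z.1 * g z.2 - f' z.1 * g' z.2) =
      (∫ θ, f θ) * (∫ θ, g θ) - (∫ θ, f' θ) * ∫ θ, g' θ := by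
  rw [integral_sub, Measure.volume_eq_prod, integral_prod_mul, integral_prod_mul]
  · exact Continuous.integrable_of_compactSpace (by fun_prop)
  · exact Continuous.integrable_of_compactSpace (by fun_prop)

theorem integral_mul_integral_le_of_inCone {f f' g g' : (ι → Real.Angle) → ℝ}
    (hf : Continuous f) (hf' : Continuous f') (hg : Continuous g) (hg' : Continuous g')
    (h : InCone (replicaMonoid (ι → Real.Angle)) fun z =>
      f (z.1 - z.2) * g (z.1 + z.2) - f' (z.1 - z.2) * g' (z.1 + z.2)) :
    (∫ θ, f' θ) * ∫ θ, g' θ ≤ (∫ θ, f θ) * ∫ θ, g θ := by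
  rw [← sub_nonneg, ← integral_prod_sub_mul hf hf' hg hg']
  exact integral_nonneg_of_inCone_rotation (by fun_prop) h

theorem frozen_mean_le_plus_mean (hJ : ∀ k l, 0 ≤ J k l) (hh : ∀ k, 0 ≤ h k)
    (hg : ∀ k l, 0 ≤ g k l) (η : κ → Real.Angle) (x : ι) :
    (∫ θ, Real.exp (plusEnergy J (fun k => h k + ∑ l, g k l) θ)) *
        ∫ θ : ι → Real.Angle, (θ x).cos * Real.exp (frozenEnergy J h g η θ) ≤
      (∫ θ : ι → Real.Angle,
          (θ x).cos * Real.exp (plusEnergy J (fun k => h k + ∑ l, g k l) θ)) *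
        ∫ θ, Real.exp (frozenEnergy J h g η θ) := by
  have hc := continuous_cos_apply x
  have hE := (continuous_plusEnergy (J := J) (h := fun k => h k + ∑ l, g k l)).rexp
  have hE' : Continuous fun θ => Real.exp (frozenEnergy J h g η θ) :=
    (continuous_frozenEnergy.comp (continuous_id.prodMk continuous_const)).rexp
  refine integral_mul_integral_le_of_inCone (hc.mul hE) hE hE' (hc.mul hE') ?_
  convert (inCone_cos_sub_cos x).mul (inCone_exp_energy hJ hh hg η) using 2 with z
  rw [Real.exp_add]; ring

theorem integral_exp_plusEnergy_pos : 0 < ∫ θ, Real.exp (plusEnergy J h θ) :=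
  integral_exp_pos continuous_plusEnergy.rexp.integrable_of_compactSpace

theorem integral_cos_mul_exp_nonneg (hJ : ∀ k l, 0 ≤ J k l) (hh : ∀ k, 0 ≤ h k) (x : ι) :
    0 ≤ ∫ θ : ι → Real.Angle, (θ x).cos * Real.exp (plusEnergy J h θ) := by
  have hc := continuous_cos_apply x
  have hE := (continuous_plusEnergy (J := J) (h := h)).rexp
  have key := integral_mul_integral_le_of_inCone (hc.mul hE) hE.neg hE (hc.mul hE) (by
    convert (inCone_cos_add_cos x).mul (inCone_exp_plusEnergy hJ hh) using 2 with z
    rw [Real.exp_add]; simp only [Pi.mul_apply, Pi.neg_apply]; ring)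
  simp only [Pi.mul_apply, Pi.neg_apply, integral_neg] at key
  nlinarith [integral_exp_plusEnergy_pos (J := J) (h := h)]

theorem integral_cos_mul_integral_cos_le (hJ : ∀ k l, 0 ≤ J k l) (hh : ∀ k, 0 ≤ h k) (x y : ι) :
    (∫ θ : ι → Real.Angle, (θ x).cos * Real.exp (plusEnergy J h θ)) *
        ∫ θ : ι → Real.Angle, (θ y).cos * Real.exp (plusEnergy J h θ) ≤
      (∫ θ : ι → Real.Angle, (θ x).cos * (θ y).cos * Real.exp (plusEnergy J h θ)) *
        ∫ θ, Real.exp (plusEnergy J h θ) := by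
  have hx := continuous_cos_apply x
  have hy := continuous_cos_apply y
  have hE := (continuous_plusEnergy (J := J) (h := h)).rexp
  have hcone := ((inCone_cos_sub_cos x).mul (inCone_cos_sub_cos y)).mul
    (inCone_exp_plusEnergy hJ hh)
  simp only [Real.exp_add] at hcone
  have key := integral_nonneg_of_inCone_rotation
      (F := fun z => ((z.1 x).cos - (z.2 x).cos) * ((z.1 y).cos - (z.2 y).cos) *
        (Real.exp (plusEnergy J h z.1) * Real.exp (plusEnergy J h z.2)))
      ((((hx.comp continuous_fst).sub (hx.comp continuous_snd)).mul
        ((hy.comp continuous_fst).sub (hy.comp continuous_snd))).mul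
        ((hE.comp continuous_fst).mul (hE.comp continuous_snd))) hcone
  set w : (ι → Real.Angle) → ℝ := fun θ => Real.exp (plusEnergy J h θ)
  set u : (ι → Real.Angle) → ℝ := fun θ => (θ x).cos
  set v : (ι → Real.Angle) → ℝ := fun θ => (θ y).cos
  have hsplit : ∀ z : (ι → Real.Angle) × (ι → Real.Angle),
      (u z.1 - u z.2) * (v z.1 - v z.2) * (w z.1 * w z.2) =
      ((u z.1 * v z.1 * w z.1) * w z.2 - (u z.1 * w z.1) * (v z.2 * w z.2)) +
        (w z.1 * (u z.2 * v z.2 * w z.2) - (v z.1 * w z.1) * (u z.2 * w z.2)) :=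
    fun z => by ring
  have huw : Continuous fun θ => u θ * w θ := hx.mul hE
  have hvw : Continuous fun θ => v θ * w θ := hy.mul hE
  have huvw : Continuous fun θ => u θ * v θ * w θ := (hx.mul hy).mul hE
  simp only [show ∀ z : (ι → Real.Angle) × (ι → Real.Angle),
    ((z.1 x).cos - (z.2 x).cos) * ((z.1 y).cos - (z.2 y).cos) *
      (Real.exp (plusEnergy J h z.1) * Real.exp (plusEnergy J h z.2)) = _ from hsplit] at key
  rw [integral_add (Continuous.integrable_of_compactSpace (by fun_prop))
    (Continuous.integrable_of_compactSpace (by fun_prop)),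
    integral_prod_sub_mul huvw huw hE hvw, integral_prod_sub_mul hE hvw huvw huw] at key
  linarith

theorem integral_sin_mul_sin_nonneg (hJ : ∀ k l, 0 ≤ J k l) (x y : ι) :
    0 ≤ ∫ θ : ι → Real.Angle, (θ x).sin * (θ y).sin * Real.exp (plusEnergy J h θ) := by
  have hc := fun k : ι => continuous_cos_apply k
  refine InCone.integral_nonneg (M := reflectionMonoid ι)
    (fun f hf => integral_nonneg_of_mem_reflectionMonoid hf) ?_
  have h1 : InCone (reflectionMonoid ι) fun θ =>
      Real.exp (∑ k, ∑ l, J k l * ((θ k).cos * (θ l).cos) + ∑ k, h k * (θ k).cos) := by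
    refine inCone_reflection_weight (by fun_prop) (fun θ => (Real.exp_pos _).le) fun k θ => ?_
    have h2 : ∀ j, (reflect k θ j).cos = (θ j).cos := fun j => by
      unfold reflect; split_ifs <;> simp
    simp only [h2]
  have h3 : InCone (reflectionMonoid ι) fun θ =>
      Real.exp (∑ k, ∑ l, J k l * ((θ k).sin * (θ l).sin)) :=
    InCone.exp const_mem_reflectionMonoid <| InCone.sum _ fun k _ => InCone.sum _ fun l _ =>
      (InCone.of_mem (const_mem_reflectionMonoid _ (hJ k l))).mul
        ((inCone_reflection_sin k).mul (inCone_reflection_sin l))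
  convert ((inCone_reflection_sin x).mul (inCone_reflection_sin y)).mul (h1.mul h3) using 3 with θ
  rw [← Real.exp_add]
  simp only [plusEnergy, Real.Angle.cos_sub', mul_add, Finset.sum_add_distrib]
  congr 1; ring

end Ginibre

/-! ### Gibbs means and volume monotonicity -/

section Mean

variable {ι ι' κ : Type*} [Fintype ι] [Fintype ι'] [Fintype κ]

/-- Gibbs mean of `F` for the energy `plusEnergy J h`. -/
noncomputable def spinMean (J : ι → ι → ℝ) (h : ι → ℝ) (F : (ι → Real.Angle) → ℝ) : ℝ :=
  (∫ θ, F θ * Real.exp (plusEnergy J h θ)) / ∫ θ, Real.exp (plusEnergy J h θ)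

theorem spinMean_cos_nonneg {J : ι → ι → ℝ} {h : ι → ℝ} (hJ : ∀ k l, 0 ≤ J k l)
    (hh : ∀ k, 0 ≤ h k) (x : ι) : 0 ≤ spinMean J h fun θ => (θ x).cos :=
  div_nonneg (integral_cos_mul_exp_nonneg hJ hh x) integral_exp_plusEnergy_pos.le

theorem spinMean_cos_mul_spinMean_cos_le {J : ι → ι → ℝ} {h : ι → ℝ} (hJ : ∀ k l, 0 ≤ J k l)
    (hh : ∀ k, 0 ≤ h k) (x y : ι) :
    (spinMean J h fun θ => (θ x).cos) * (spinMean J h fun θ => (θ y).cos) ≤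
      spinMean J h fun θ => (θ x - θ y).cos := by
  have hZ := integral_exp_plusEnergy_pos (J := J) (h := h)
  have hcc := integral_cos_mul_integral_cos_le hJ hh x y
  have hss := integral_sin_mul_sin_nonneg (h := h) hJ x y
  have hE := (continuous_plusEnergy (J := J) (h := h)).rexp
  have hs := fun k : ι => Real.Angle.continuous_sin.comp
    (continuous_apply (A := fun _ : ι => Real.Angle) k)
  have hsum : ∫ θ : ι → Real.Angle, (θ x - θ y).cos * Real.exp (plusEnergy J h θ) =
      (∫ θ : ι → Real.Angle, (θ x).cos * (θ y).cos * Real.exp (plusEnergy J h θ)) +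
        ∫ θ : ι → Real.Angle, (θ x).sin * (θ y).sin * Real.exp (plusEnergy J h θ) := by
    rw [← integral_add]
    · simp only [Real.Angle.cos_sub', add_mul]
    · exact Continuous.integrable_of_compactSpace
        (((continuous_cos_apply x).mul (continuous_cos_apply y)).mul hE)
    · exact Continuous.integrable_of_compactSpace (((hs x).mul (hs y)).mul hE)
  unfold spinMean
  rw [hsum, div_mul_div_comm, div_le_div_iff₀ (by positivity) hZ]
  nlinarith [mul_nonneg hss (sq_nonneg (∫ θ, Real.exp (plusEnergy J h θ)))]

theorem integral_sum_type {F : (ι → Real.Angle) × (κ → Real.Angle) → ℝ} (hF : Continuous F) :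
    ∫ θ : ι ⊕ κ → Real.Angle, F (θ ∘ Sum.inl, θ ∘ Sum.inr) = ∫ η, ∫ φ, F (φ, η) := by
  have h1 := (volume_measurePreserving_sumPiEquivProdPi
    fun _ : ι ⊕ κ => Real.Angle).integral_comp_continuous hF
  rw [Measure.volume_eq_prod, integral_prod_symm _ hF.integrable_of_compactSpace] at h1
  exact h1

theorem plusEnergy_sum_type (J : ι ⊕ κ → ι ⊕ κ → ℝ) (h : ι ⊕ κ → ℝ)
    (θ : ι ⊕ κ → Real.Angle) :
    plusEnergy J h θ =
      frozenEnergy (fun k l => J (.inl k) (.inl l)) (fun k => h (.inl k))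
        (fun k l => J (.inl k) (.inr l) + J (.inr l) (.inl k)) (θ ∘ Sum.inr) (θ ∘ Sum.inl) +
      plusEnergy (fun k l => J (.inr k) (.inr l)) (fun k => h (.inr k)) (θ ∘ Sum.inr) := by
  have hsymm : ∀ k l, (θ (.inr l) - θ (.inl k)).cos = (θ (.inl k) - θ (.inr l)).cos :=
    fun k l => by rw [← Real.Angle.cos_neg, neg_sub]
  have hcomm : ∑ l : κ, ∑ k : ι, J (.inr l) (.inl k) * (θ (.inr l) - θ (.inl k)).cos =
      ∑ k : ι, ∑ l : κ, J (.inr l) (.inl k) * (θ (.inl k) - θ (.inr l)).cos := by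
    rw [Finset.sum_comm]; simp only [hsymm]
  simp only [plusEnergy, frozenEnergy, Fintype.sum_sum_type, Finset.sum_add_distrib, add_mul,
    Function.comp_apply, hcomm]
  ring

theorem spinMean_sum_type_le {J : ι ⊕ κ → ι ⊕ κ → ℝ} {h : ι ⊕ κ → ℝ} (hJ : ∀ k l, 0 ≤ J k l)
    (hh : ∀ k, 0 ≤ h k) (x : ι) :
    (spinMean J h fun θ => (θ (.inl x)).cos) ≤
      spinMean (fun k l => J (.inl k) (.inl l))
        (fun k => h (.inl k) + ∑ l, (J (.inl k) (.inr l) + J (.inr l) (.inl k)))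
        fun θ => (θ x).cos := by
  unfold spinMean
  rw [div_le_div_iff₀ integral_exp_plusEnergy_pos integral_exp_plusEnergy_pos]
  set Zp := ∫ θ, Real.exp (plusEnergy (fun k l => J (.inl k) (.inl l))
    (fun k => h (.inl k) + ∑ l, (J (.inl k) (.inr l) + J (.inr l) (.inl k))) θ)
  set Np := ∫ θ : ι → Real.Angle, (θ x).cos *
    Real.exp (plusEnergy (fun k l => J (.inl k) (.inl l))
      (fun k => h (.inl k) + ∑ l, (J (.inl k) (.inr l) + J (.inr l) (.inl k))) θ)
  set w : (ι → Real.Angle) × (κ → Real.Angle) → ℝ := fun z =>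
    Real.exp (frozenEnergy (fun k l => J (.inl k) (.inl l)) (fun k => h (.inl k))
      (fun k l => J (.inl k) (.inr l) + J (.inr l) (.inl k)) z.2 z.1) with hw
  set r : (κ → Real.Angle) → ℝ := fun η =>
    Real.exp (plusEnergy (fun k l => J (.inr k) (.inr l)) (fun k => h (.inr k)) η) with hr
  have hwc : Continuous w := continuous_frozenEnergy.rexp
  have hrc : Continuous r := continuous_plusEnergy.rexp
  have hcx : Continuous fun z : (ι → Real.Angle) × (κ → Real.Angle) => (z.1 x).cos :=
    (continuous_cos_apply x).comp continuous_fst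
  have hwr : Continuous fun z => w z * r z.2 := hwc.mul (hrc.comp continuous_snd)
  have hcwr : Continuous fun z => (z.1 x).cos * w z * r z.2 :=
    (hcx.mul hwc).mul (hrc.comp continuous_snd)
  have hN : ∫ θ : ι ⊕ κ → Real.Angle, (θ (.inl x)).cos * Real.exp (plusEnergy J h θ) =
      ∫ η, ∫ φ, (φ x).cos * w (φ, η) * r η := by
    rw [← integral_sum_type hcwr]
    simp only [plusEnergy_sum_type, Real.exp_add, hw, hr, Function.comp_apply, mul_assoc]
  have hZ : ∫ θ, Real.exp (plusEnergy J h θ) = ∫ η, ∫ φ, w (φ, η) * r η := by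
    rw [← integral_sum_type hwr]
    simp only [plusEnergy_sum_type, Real.exp_add, hw, hr]
  rw [hN, hZ, mul_comm, ← integral_const_mul, ← integral_const_mul]
  refine integral_mono
    ((Continuous.integrable_of_compactSpace hcwr).integral_prod_right.const_mul _)
    ((Continuous.integrable_of_compactSpace hwr).integral_prod_right.const_mul _) fun η => ?_
  simp only [integral_mul_const, ← mul_assoc]
  exact mul_le_mul_of_nonneg_right (frozen_mean_le_plus_mean (fun k l => hJ _ _)
    (fun k => hh _) (fun k l => add_nonneg (hJ _ _) (hJ _ _)) η x) (Real.exp_pos _).le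

theorem spinMean_reindex (e : ι ≃ ι') (J : ι' → ι' → ℝ) (h : ι' → ℝ)
    {F : (ι' → Real.Angle) → ℝ} (hF : Continuous F) :
    spinMean J h F =
      spinMean (fun k l => J (e k) (e l)) (fun k => h (e k)) fun θ => F (θ ∘ e.symm) := by
  have hmp : MeasurePreserving (fun θ : ι → Real.Angle => θ ∘ e.symm) volume volume :=
    volume_preserving_arrowCongr' e (MeasurableEquiv.refl Real.Angle) (.id _)
  have hE := (continuous_plusEnergy (J := J) (h := h)).rexp
  have hFE : Continuous fun θ => F θ * Real.exp (plusEnergy J h θ) := hF.mul hE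
  have henergy : ∀ θ : ι → Real.Angle, plusEnergy J h (θ ∘ e.symm) =
      plusEnergy (fun k l => J (e k) (e l)) (fun k => h (e k)) θ := fun θ => by
    simp only [plusEnergy, ← e.sum_comp, Function.comp_apply, Equiv.symm_apply_apply]
  unfold spinMean
  rw [← hmp.integral_comp_continuous hE, ← hmp.integral_comp_continuous hFE]
  simp only [henergy]

theorem spinMean_cos_le_of_injective {f : ι → ι'} (hf : f.Injective) {J : ι' → ι' → ℝ}
    {h : ι → ℝ} {h' : ι' → ℝ} (hJ : ∀ k l, 0 ≤ J k l) (hsymm : ∀ k l, J k l = J l k)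
    (hh : ∀ k, 0 ≤ h' k)
    (hbalance : ∀ k, h k + 2 * ∑ l, J (f k) (f l) = h' (f k) + 2 * ∑ l, J (f k) l) (x : ι) :
    (spinMean J h' fun θ => (θ (f x)).cos) ≤
      spinMean (fun k l => J (f k) (f l)) h fun θ => (θ x).cos := by
  classical
  let e : ι ⊕ ↥(Set.range f)ᶜ ≃ ι' :=
    (Equiv.sumCongr (Equiv.ofInjective f hf) (Equiv.refl _)).trans (Equiv.Set.sumCompl _)
  have he : ∀ k, e (.inl k) = f k := fun k => rfl
  rw [spinMean_reindex e J h' (continuous_cos_apply (f x))]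
  have hx : e.symm (f x) = .inl x := by rw [← he, Equiv.symm_apply_apply]
  simp only [Function.comp_apply, hx]
  refine (spinMean_sum_type_le (fun k l => hJ _ _) (fun k => hh _) x).trans_eq ?_
  congr 1
  funext k
  have h1 := hbalance k
  rw [← e.sum_comp, Fintype.sum_sum_type] at h1
  simp only [he, hsymm (e (.inr _)), Finset.sum_add_distrib] at h1 ⊢
  linarith

end Mean

/-! ### Comparison with the lattice model -/

theorem setIntegral_pi_Icc_eq {ι : Type*} [Fintype ι] {F : (ι → Real.Angle) → ℝ}
    (hF : Continuous F) :
    ∫ θ in Set.univ.pi fun _ : ι => Set.Icc (0 : ℝ) (2 * π), F (fun k => (θ k : Real.Angle)) =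
      ∫ θ, F θ := by
  have h1 : MeasurePreserving (fun r : ℝ => (r : Real.Angle))
      (volume.restrict (Set.Icc 0 (2 * π))) volume := by
    have h := AddCircle.measurePreserving_mk (2 * π) 0
    rw [zero_add, Measure.restrict_congr_set Ioc_ae_eq_Icc] at h
    exact h
  have h2 := measurePreserving_pi (fun _ : ι => volume.restrict (Set.Icc (0 : ℝ) (2 * π)))
    (fun _ : ι => (volume : Measure Real.Angle)) (fun _ => h1)
  rw [← Measure.restrict_pi_pi] at h2
  exact h2.integral_comp_continuous hF

/-- Nearest-neighbor couplings on `Λ_L°`. -/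
noncomputable def latticeCoupling (L : ℕ) (β : ℝ) (k l : ↥(interF L)) : ℝ :=
  if adj k.1 l.1 then β / 6 else 0

/-- Boundary fields on `Λ_L°`. -/
noncomputable def latticeField (L : ℕ) (β : ℝ) (k : ↥(interF L)) : ℝ := β / 3 * nBd L k.1

theorem energyP_eq (L : ℕ) (β : ℝ) (θ : Cfg L) :
    energyP L β θ =
      plusEnergy (latticeCoupling L β) (latticeField L β) fun k => (θ k : Real.Angle) := by
  simp only [energyP, energy0, plusEnergy, latticeCoupling, latticeField, ← Real.Angle.coe_sub,
    Real.Angle.cos_coe, Finset.mul_sum, ite_mul, mul_ite, zero_mul, mul_zero, mul_assoc]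

theorem avgP_eq_spinMean (L : ℕ) (β : ℝ) {F : (↥(interF L) → Real.Angle) → ℝ}
    (hF : Continuous F) :
    avgP L β (fun θ => F fun k => (θ k : Real.Angle)) =
      spinMean (latticeCoupling L β) (latticeField L β) F := by
  have hE := (continuous_plusEnergy (J := latticeCoupling L β) (h := latticeField L β)).rexp
  have hFE : Continuous fun θ =>
      F θ * Real.exp (plusEnergy (latticeCoupling L β) (latticeField L β) θ) := hF.mul hE
  unfold avgP spinMean cube
  rw [← setIntegral_pi_Icc_eq hE, ← setIntegral_pi_Icc_eq hFE]
  simp only [energyP_eq]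

theorem magAt_eq_spinMean (β : ℝ) {L : ℕ} {x : Site} (hx : x ∈ interF L) :
    magAt L β x = spinMean (latticeCoupling L β) (latticeField L β)
      fun θ => (θ ⟨x, hx⟩).cos := by
  rw [← avgP_eq_spinMean L β (continuous_cos_apply _)]
  simp [magAt, val, hx]

theorem corrPlus_eq_spinMean (β : ℝ) {L : ℕ} {x y : Site} (hx : x ∈ interF L)
    (hy : y ∈ interF L) :
    corrPlus L β x y = spinMean (latticeCoupling L β) (latticeField L β)
      fun θ => (θ ⟨x, hx⟩ - θ ⟨y, hy⟩).cos := by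
  have hc : Continuous fun θ : ↥(interF L) → Real.Angle => (θ ⟨x, hx⟩ - θ ⟨y, hy⟩).cos :=
    Real.Angle.continuous_cos.comp (by fun_prop)
  rw [← avgP_eq_spinMean L β hc]
  simp [corrPlus, val, hx, hy, ← Real.Angle.coe_sub]

theorem latticeCoupling_nonneg {β : ℝ} (hβ : 0 < β) (L : ℕ) (k l : ↥(interF L)) :
    0 ≤ latticeCoupling L β k l := by
  unfold latticeCoupling; split_ifs <;> positivity

theorem latticeField_nonneg {β : ℝ} (hβ : 0 < β) (L : ℕ) (k : ↥(interF L)) :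
    0 ≤ latticeField L β k := by
  unfold latticeField; positivity

theorem adj_comm (k l : Site) : adj k l ↔ adj l k := by
  simp only [adj, abs_sub_comm]

theorem adj_sub_sub (k l x : Site) : adj (k - x) (l - x) ↔ adj k l := by
  simp [adj]

theorem mem_interF_iff {L : ℕ} {x : Site} : x ∈ interF L ↔ ∀ i, |x i| < (L : ℤ) := by
  simp only [interF, Finset.mem_Icc, Pi.le_def, ← forall_and, abs_lt]
  exact forall_congr' fun i => by omega

theorem mem_lamF_iff {L : ℕ} {x : Site} : x ∈ lamF L ↔ ∀ i, |x i| ≤ (L : ℤ) := by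
  simp only [lamF, Finset.mem_Icc, Pi.le_def, ← forall_and, abs_le]

theorem abs_le_supNorm (x : Site) (i : Fin 3) : |x i| ≤ supNorm x := by
  fin_cases i <;> simp [supNorm]

theorem supNorm_lt_iff {L : ℕ} {x : Site} : supNorm x < (L : ℤ) ↔ x ∈ interF L := by
  simp [mem_interF_iff, supNorm, Fin.forall_fin_succ]

theorem abs_sub_le_one_of_adj {k l : Site} (h : adj k l) (i : Fin 3) : |k i - l i| ≤ 1 :=
  h ▸ Finset.single_le_sum (f := fun i => |k i - l i|) (fun _ _ => abs_nonneg _)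
    (Finset.mem_univ i)

theorem card_neighbors {L : ℕ} {k : Site} (hk : k ∈ interF L) :
    ((lamF L).filter fun l => adj k l).card = ((lamF 1).filter fun l => adj 0 l).card := by
  rw [mem_interF_iff] at hk
  refine Finset.card_bij' (fun l _ => l - k) (fun l _ => l + k) ?_ ?_ ?_ ?_
  · intro l hl
    rw [Finset.mem_filter, mem_lamF_iff] at hl ⊢
    refine ⟨fun i => ?_, ?_⟩
    · have := abs_sub_le_one_of_adj hl.2 i
      rw [abs_sub_comm] at this
      simpa using this
    · rw [← adj_sub_sub k l k, sub_self] at hl; exact hl.2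
  · intro l hl
    rw [Finset.mem_filter, mem_lamF_iff] at hl ⊢
    refine ⟨fun i => ?_, ?_⟩
    · have h1 := hl.1 i
      have h2 := hk i
      have h3 := abs_add_le (l i) (k i)
      simp only [Pi.add_apply]
      push_cast at h1
      omega
    · rw [← adj_sub_sub k _ k, sub_self, add_sub_cancel_right]; exact hl.2
  · intro l _; simp
  · intro l _; simp

theorem latticeField_add_sum {L : ℕ} (β : ℝ) (k : ↥(interF L)) :
    latticeField L β k + 2 * ∑ l, latticeCoupling L β k l =
      β / 3 * ((lamF 1).filter fun l => adj 0 l).card := by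
  have hsub : interF L ⊆ lamF L := fun x hx => by
    rw [mem_interF_iff] at hx; rw [mem_lamF_iff]; exact fun i => (hx i).le
  have h1 : ∑ l, latticeCoupling L β k l =
      ((interF L).filter fun l => adj k.1 l).card * (β / 6) := by
    refine (Finset.sum_coe_sort (interF L) fun l => if adj k.1 l then β / 6 else 0).trans ?_
    rw [← Finset.sum_filter, Finset.sum_const, nsmul_eq_mul]
  have h3 : nBd L k.1 + ((interF L).filter fun l => adj k.1 l).card =
      ((lamF 1).filter fun l => adj 0 l).card := by
    rw [← card_neighbors k.2, nBd, ← Finset.card_union_of_disjoint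
      (Finset.disjoint_filter_filter Finset.sdiff_disjoint), ← Finset.filter_union,
      Finset.sdiff_union_of_subset hsub]
  rw [h1, latticeField, ← h3]
  push_cast
  ring

theorem magAt_nonneg {β : ℝ} (hβ : 0 < β) {L : ℕ} {x : Site} (hx : x ∈ interF L) :
    0 ≤ magAt L β x := by
  rw [magAt_eq_spinMean β hx]
  exact spinMean_cos_nonneg (latticeCoupling_nonneg hβ L) (latticeField_nonneg hβ L) _

theorem magAt_sub_le {β : ℝ} (hβ : 0 < β) {L L' : ℕ} {x v : Site} (hx : x ∈ interF L)
    (hsub : ∀ k ∈ interF L, k - v ∈ interF L') : magAt L' β (x - v) ≤ magAt L β x := by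
  let f : ↥(interF L) → ↥(interF L') := fun k => ⟨k.1 - v, hsub k.1 k.2⟩
  have hf : f.Injective := fun k l h => Subtype.ext (sub_left_injective (congrArg Subtype.val h))
  have hJ : ∀ k l, latticeCoupling L' β (f k) (f l) = latticeCoupling L β k l := fun k l => by
    simp only [latticeCoupling, f, adj_sub_sub]
  rw [magAt_eq_spinMean β hx, magAt_eq_spinMean β (hsub x hx)]
  have h := spinMean_cos_le_of_injective hf (h := latticeField L β)
    (latticeCoupling_nonneg hβ L') (fun k l => by simp only [latticeCoupling, adj_comm])
    (latticeField_nonneg hβ L') (fun k => by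
      simp only [hJ]; rw [latticeField_add_sum, latticeField_add_sum]) ⟨x, hx⟩
  simpa only [hJ] using h

theorem zero_mem_interF {L : ℕ} (hL : 2 ≤ L) : (0 : Site) ∈ interF L := by
  rw [mem_interF_iff]; intro i; simp; omega

theorem mStar_nonneg {β : ℝ} (hβ : 0 < β) : 0 ≤ mStar β := by
  refine Real.sInf_nonneg ?_
  rintro r ⟨L, hL, rfl⟩
  exact magAt_nonneg hβ (zero_mem_interF hL)

theorem mStar_le_magAt {β : ℝ} (hβ : 0 < β) {L : ℕ} {x : Site} (hx : x ∈ interF L) :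
    mStar β ≤ magAt L β x := by
  have hbdd : BddBelow {r : ℝ | ∃ L : ℕ, 2 ≤ L ∧ r = magAt L β 0} := by
    refine ⟨0, ?_⟩
    rintro r ⟨L, hL, rfl⟩
    exact magAt_nonneg hβ (zero_mem_interF hL)
  refine (csInf_le hbdd ⟨2 * L + 2, by omega, rfl⟩).trans ?_
  rw [← sub_self x]
  refine magAt_sub_le hβ hx fun k hk => ?_
  rw [mem_interF_iff] at hk hx ⊢
  intro i
  have h1 := hk i
  have h2 := hx i
  have h3 := abs_sub (k i) (x i)
  simp only [Pi.sub_apply]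
  push_cast
  omega

/-- `m*(β)²` is dominated by the infinite-volume plus-boundary two-point function. -/
theorem mStar_sq_le_plus_two_point
    (β : ℝ) (hβ : 0 < β) (x y : Site) :
    mStar β ^ 2
      ≤ sInf {r : ℝ | ∃ L : ℕ, max (supNorm x) (supNorm y) < (L : ℤ) ∧ r = corrPlus L β x y} := by
  have hne : ∃ L : ℕ, max (supNorm x) (supNorm y) < (L : ℤ) :=
    ⟨(max (supNorm x) (supNorm y)).toNat + 1, by omega⟩
  refine le_csInf (hne.imp' (fun L => corrPlus L β x y) fun L hL => ⟨L, hL, rfl⟩) ?_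
  rintro r ⟨L, hL, rfl⟩
  rw [max_lt_iff, supNorm_lt_iff, supNorm_lt_iff] at hL
  obtain ⟨hx, hy⟩ := hL
  calc mStar β ^ 2 = mStar β * mStar β := sq _
    _ ≤ magAt L β x * magAt L β y :=
        mul_le_mul (mStar_le_magAt hβ hx) (mStar_le_magAt hβ hy) (mStar_nonneg hβ)
          (magAt_nonneg hβ hx)
    _ ≤ corrPlus L β x y := by
        rw [magAt_eq_spinMean β hx, magAt_eq_spinMean β hy, corrPlus_eq_spinMean β hx hy]
        exact spinMean_cos_mul_spinMean_cos_le (latticeCoupling_nonneg hβ L)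
          (latticeField_nonneg hβ L) _ _
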